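/- arXiv:1702.03472 — 4 statements merged into one kernel-verified Lean document; each statement's English description precedes it below -/
import Mathlib

section
/- Let n ≥ 1 and let i_1, …, i_n be positive natural numbers. Then the alternating sum ∑_{k=1}^{i_1⋯i_n} (−1)^{k−1} t_k(i_1,…,i_n) equals ∏_{j=1}^n (−1)^{i_j − 1}, i.e. equals (−1)^{i_1+⋯+i_n+n}. (This is the paper's Theorem 1; the paper writes the right-hand side as (−1)^{i_1+⋯+i_n}, which agrees with this value exactly when n is even, in particular in the two-dimensional case of Wang, Lee and Tan; the sign given here is the one the paper's own final product computation yields and is the correct one, as the case n = 1, i_1 = 1 shows.) -/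
section FullyProjected

variable {ι : Type*} [Fintype ι] [DecidableEq ι] {α : ι → Type*} [∀ j, Fintype (α j)]
  [∀ j, DecidableEq (α j)]

/-- The alternating sum over the subsets of `α` other than `univ`. -/
lemma sum_neg_one_pow_card_of_ne_univ (α : Type*) [Fintype α] [DecidableEq α] [Nonempty α] :
    ∑ D : Finset α, (if D = Finset.univ then 0 else (-1 : ℤ) ^ D.card)
      = (-1) ^ (Fintype.card α + 1) := by
  have h : ∑ D : Finset α, (-1 : ℤ) ^ D.card = 0 := by
    simpa using Finset.sum_powerset_neg_one_pow_card_of_nonempty (Finset.univ_nonempty (α := α))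
  have h' : ∀ D : Finset α, (if D = Finset.univ then 0 else (-1 : ℤ) ^ D.card)
      = (-1) ^ D.card - if D = Finset.univ then (-1) ^ Fintype.card α else 0 := by
    intro D
    split_ifs with hD <;> simp [hD]
  simp [h', h, pow_succ]

/-- Inclusion-exclusion for the condition that every projection of `S` is surjective. -/
lemma sum_prod_avoiding_eq_ite (S : Finset (∀ j, α j)) :
    ∑ D : ∀ j, Finset (α j), (if ∀ x ∈ S, ∀ j, x j ∉ D j then ∏ j, (-1 : ℤ) ^ (D j).card else 0)
      = if ∀ j, ∀ a : α j, ∃ x ∈ S, x j = a then 1 else 0 := by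
  have hfactor : ∀ j, ∑ D : Finset (α j),
      (if ∀ x ∈ S, x j ∉ D then (-1 : ℤ) ^ D.card else 0)
        = if ∀ a : α j, ∃ x ∈ S, x j = a then 1 else 0 := by
    intro j
    have hfilter : Finset.univ.filter (fun D : Finset (α j) => ∀ x ∈ S, x j ∉ D)
        = (S.image (fun x => x j))ᶜ.powerset := by
      ext D
      simp only [Finset.mem_filter, Finset.mem_univ, true_and, Finset.mem_powerset,
        Finset.subset_iff, Finset.mem_compl, Finset.mem_image]
      grind
    rw [← Finset.sum_filter, hfilter, Finset.sum_powerset_neg_one_pow_card]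
    simp [Finset.eq_univ_iff_forall]
  calc _ = ∑ D : ∀ j, Finset (α j),
        ∏ j, (if ∀ x ∈ S, x j ∉ D j then (-1 : ℤ) ^ (D j).card else 0) := by
        refine Finset.sum_congr rfl fun D _ => ?_
        by_cases h : ∀ x ∈ S, ∀ j, x j ∉ D j
        · rw [if_pos h]
          exact Finset.prod_congr rfl fun j _ => (if_pos fun x hx => h x hx j).symm
        · rw [if_neg h]
          push Not at h
          obtain ⟨x, hx, j, hj⟩ := h
          exact (Finset.prod_eq_zero (Finset.mem_univ j) (if_neg fun h => h x hx hj)).symm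
    _ = ∏ j, ∑ D : Finset (α j), (if ∀ x ∈ S, x j ∉ D then (-1 : ℤ) ^ D.card else 0) := by
        rw [Finset.prod_univ_sum, Fintype.piFinset_univ]
    _ = _ := by
        simp only [hfactor, Finset.prod_ite_zero, Finset.prod_const_one, Finset.mem_univ,
          forall_true_left]

/-- The alternating sum over the subsets of `∏ j, α j` that avoid every `D j`. -/
lemma sum_neg_one_pow_card_avoiding (D : ∀ j, Finset (α j)) :
    ∑ S : Finset (∀ j, α j), (if ∀ x ∈ S, ∀ j, x j ∉ D j then (-1 : ℤ) ^ S.card else 0)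
      = 1 - if ∀ j, D j ≠ Finset.univ then 1 else 0 := by
  have hfilter : Finset.univ.filter (fun S : Finset (∀ j, α j) => ∀ x ∈ S, ∀ j, x j ∉ D j)
      = (Fintype.piFinset fun j => (D j)ᶜ).powerset := by
    ext S
    simp [Finset.subset_iff]
  have hempty : Fintype.piFinset (fun j => (D j)ᶜ) = ∅ ↔ ¬ ∀ j, D j ≠ Finset.univ := by
    simp
  rw [← Finset.sum_filter, hfilter, Finset.sum_powerset_neg_one_pow_card]
  simp only [hempty]
  split_ifs <;> simp_all

/-- The signed count of the subsets of `∏ j, α j` all of whose projections are surjective. -/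
lemma sum_neg_one_pow_card_fully_projected [Nonempty ι] [∀ j, Nonempty (α j)] :
    ∑ S : Finset (∀ j, α j),
        (if ∀ j, ∀ a : α j, ∃ x ∈ S, x j = a then (-1 : ℤ) ^ S.card else 0)
      = -∏ j, (-1) ^ (Fintype.card (α j) + 1) := by
  have hzero : ∑ D : ∀ j, Finset (α j), ∏ j, (-1 : ℤ) ^ (D j).card = 0 := by
    rw [← Fintype.piFinset_univ,
      ← Finset.prod_univ_sum (fun _ => Finset.univ)
        fun j (D : Finset (α j)) => (-1 : ℤ) ^ D.card]
    refine Finset.prod_eq_zero (Finset.mem_univ (Classical.arbitrary ι)) ?_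
    simpa using Finset.sum_powerset_neg_one_pow_card_of_nonempty
      (Finset.univ_nonempty (α := α (Classical.arbitrary ι)))
  have hproper : ∑ D : ∀ j, Finset (α j),
      (if ∀ j, D j ≠ Finset.univ then ∏ j, (-1 : ℤ) ^ (D j).card else 0)
        = ∏ j, (-1) ^ (Fintype.card (α j) + 1) := by
    simp only [← sum_neg_one_pow_card_of_ne_univ]
    rw [Finset.prod_univ_sum, Fintype.piFinset_univ]
    refine Finset.sum_congr rfl fun D _ => ?_
    simp only [← ite_not (_ = _), Finset.prod_ite_zero, Finset.mem_univ, forall_true_left, ne_eq]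
  calc _ = ∑ S : Finset (∀ j, α j), ∑ D : ∀ j, Finset (α j), (∏ j, (-1 : ℤ) ^ (D j).card) *
        (if ∀ x ∈ S, ∀ j, x j ∉ D j then (-1 : ℤ) ^ S.card else 0) := by
        refine Finset.sum_congr rfl fun S _ => ?_
        rw [← mul_boole, ← sum_prod_avoiding_eq_ite, Finset.mul_sum]
        refine Finset.sum_congr rfl fun D _ => ?_
        split_ifs <;> ring
    _ = ∑ D : ∀ j, Finset (α j), (∏ j, (-1 : ℤ) ^ (D j).card) *
        (1 - if ∀ j, D j ≠ Finset.univ then 1 else 0) := by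
        rw [Finset.sum_comm]
        simp only [← Finset.mul_sum, sum_neg_one_pow_card_avoiding]
    _ = _ := by
        simp only [mul_sub, mul_one, mul_boole, Finset.sum_sub_distrib, hzero, hproper, zero_sub]

end FullyProjected


/-- Theorem 1 of the paper (with the corrected sign): for positive `i 1, …, i n`,
the alternating sum `∑_{k=1}^{i_1⋯i_n} (-1)^(k-1) t_k` of the numbers of
fully-projected `k`-subsets of `I_1 × ⋯ × I_n` equals `(-1)^(i_1+⋯+i_n+n)`. -/
theorem fully_projected_alternating_sum (n : ℕ) (hn : 1 ≤ n)
    (i : Fin n → ℕ) (hi : ∀ j, 1 ≤ i j) :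
    ∑ k ∈ Finset.Icc 1 (∏ j, i j),
      (-1 : ℤ) ^ (k - 1) *
        ((Finset.univ.filter (fun S : Finset ((j : Fin n) → Fin (i j)) =>
            S.card = k ∧ ∀ j, ∀ a : Fin (i j), ∃ x ∈ S, x j = a)).card : ℤ)
      = (-1) ^ (∑ j, i j + n) := by
  have : Nonempty (Fin n) := ⟨⟨0, hn⟩⟩
  have : ∀ j, Nonempty (Fin (i j)) := fun j => ⟨⟨0, hi j⟩⟩
  have hcard : ∀ S ∈ Finset.univ.filter (fun S : Finset ((j : Fin n) → Fin (i j)) =>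
      ∀ j, ∀ a : Fin (i j), ∃ x ∈ S, x j = a), S.card ∈ Finset.Icc 1 (∏ j, i j) := by
    intro S hS
    obtain ⟨x, hx, -⟩ := (Finset.mem_filter.1 hS).2 ⟨0, hn⟩ ⟨0, hi _⟩
    refine Finset.mem_Icc.2 ⟨Finset.card_pos.2 ⟨x, hx⟩, ?_⟩
    simpa using S.card_le_univ
  have hmain : ∑ S ∈ Finset.univ.filter (fun S : Finset ((j : Fin n) → Fin (i j)) =>
      ∀ j, ∀ a : Fin (i j), ∃ x ∈ S, x j = a), (-1 : ℤ) ^ S.card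
        = -∏ j, (-1) ^ (Fintype.card (Fin (i j)) + 1) := by
    rw [← sum_neg_one_pow_card_fully_projected, Finset.sum_filter]
    congr!
  rw [← Finset.sum_fiberwise_of_maps_to hcard, ← neg_eq_iff_eq_neg] at hmain
  simp only [Fintype.card_fin, Finset.prod_pow_eq_pow_sum, Finset.sum_add_distrib,
    Finset.sum_const, Finset.card_univ, smul_eq_mul, mul_one] at hmain
  rw [← hmain, ← Finset.sum_neg_distrib]
  refine Finset.sum_congr rfl fun k hk => ?_
  obtain ⟨m, rfl⟩ := Nat.exists_eq_add_of_le' (Finset.mem_Icc.1 hk).1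
  rw [Finset.filter_filter, Finset.sum_congr rfl (g := fun _ => (-1 : ℤ) ^ (m + 1)) (by grind),
    Finset.sum_const, nsmul_eq_mul, Nat.add_sub_cancel, pow_succ]
  simp only [and_comm]
  ring
end

section
/- Let n ≥ 1, let i_1, …, i_n be positive natural numbers, and let k ≥ 1. Then the number of fully-projected k-element subsets satisfies t_k(i_1,…,i_n) = ∑_{m_1=0}^{i_1} ⋯ ∑_{m_n=0}^{i_n} (−1)^{m_1+⋯+m_n} · C(i_1, m_1) ⋯ C(i_n, m_n) · C((i_1 − m_1)⋯(i_n − m_n), k), where C(a,b) denotes the binomial coefficient. -/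
open Finset in
/-- A sum over families of subsets that only depends on the cardinalities of the subsets. -/
theorem sum_comp_card_pi {ι : Type*} [Fintype ι] [DecidableEq ι] {α : ι → Type*}
    [∀ j, Fintype (α j)] [∀ j, DecidableEq (α j)] {R : Type*} [CommSemiring R]
    (f : (ι → ℕ) → R) :
    ∑ A : (j : ι) → Finset (α j), f (fun j => #(A j)) =
      ∑ m ∈ Fintype.piFinset (fun j => range (Fintype.card (α j) + 1)),
        (∏ j, ((Fintype.card (α j)).choose (m j) : R)) * f m := by
  rw [← sum_fiberwise_of_maps_to (s := univ)
    (t := Fintype.piFinset (fun j => range (Fintype.card (α j) + 1)))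
    (g := fun A : (j : ι) → Finset (α j) => fun j => #(A j))
    (fun A _ => by simp [card_le_univ])]
  refine sum_congr rfl fun m _ => ?_
  have hfiber : univ.filter (fun A : (j : ι) → Finset (α j) => (fun j => #(A j)) = m) =
      Fintype.piFinset (fun j => powersetCard (m j) univ) := by
    ext A
    simp [funext_iff]
  rw [sum_congr rfl fun A hA => congrArg f (mem_filter.1 hA).2, sum_const, hfiber,
    Fintype.card_piFinset, nsmul_eq_mul]
  simp

open Finset in
/-- The indicator of surjectivity of a projection, as an alternating sum over the sets
that the projection avoids. -/
theorem sum_neg_one_pow_card_of_disjoint {α : Type*} [Fintype α] [DecidableEq α]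
    (T : Finset α) :
    ∑ A : Finset α, (if Disjoint A T then (-1 : ℤ) ^ #A else 0) =
      if T = univ then 1 else 0 := by
  rw [← sum_filter]
  have hfilter : univ.filter (fun A : Finset α => Disjoint A T) = Tᶜ.powerset := by
    ext A
    simp [subset_compl_iff_disjoint_right]
  rw [hfilter, sum_powerset_neg_one_pow_card]
  simp

open Finset in
/-- The number of `k`-subsets of a product all of whose projections avoid given sets. -/
theorem card_filter_disjoint_projections {ι : Type*} [Fintype ι] [DecidableEq ι]
    {α : ι → Type*} [∀ j, Fintype (α j)] [∀ j, DecidableEq (α j)] (k : ℕ)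
    (A : (j : ι) → Finset (α j))
    [DecidablePred fun S : Finset ((j : ι) → α j) =>
      ∀ j, Disjoint (A j) (S.image (fun x => x j))] :
    #((powersetCard k (univ : Finset ((j : ι) → α j))).filter
        (fun S => ∀ j, Disjoint (A j) (S.image (fun x => x j)))) =
      (∏ j, (Fintype.card (α j) - #(A j))).choose k := by
  have hfilter : (powersetCard k (univ : Finset ((j : ι) → α j))).filter
        (fun S => ∀ j, Disjoint (A j) (S.image (fun x => x j))) =
      powersetCard k (Fintype.piFinset fun j => (A j)ᶜ) := by
    ext S
    simp only [mem_filter, mem_powersetCard, disjoint_right, mem_image,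
      subset_iff, Fintype.mem_piFinset, mem_compl]
    constructor
    · rintro ⟨⟨-, hk⟩, h⟩
      exact ⟨fun x hx j => h j ⟨x, hx, rfl⟩, hk⟩
    · rintro ⟨h, hk⟩
      refine ⟨⟨fun x _ => mem_univ x, hk⟩, ?_⟩
      rintro j _ ⟨x, hx, rfl⟩
      exact h hx j
  rw [hfilter, card_powersetCard, Fintype.card_piFinset]
  simp only [card_compl]

/-- The inclusion-exclusion formula for the number `t_k` of fully-projected
`k`-subsets of `I_1 × ⋯ × I_n`:
`t_k = ∑_{m_1=0}^{i_1} ⋯ ∑_{m_n=0}^{i_n} (-1)^(m_1+⋯+m_n) C(i_1,m_1)⋯C(i_n,m_n)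
  C((i_1-m_1)⋯(i_n-m_n), k)`. -/
theorem fully_projected_count_formula (n : ℕ) (hn : 1 ≤ n)
    (i : Fin n → ℕ) (hi : ∀ j, 1 ≤ i j) (k : ℕ) (hk : 1 ≤ k) :
    ((Finset.univ.filter (fun S : Finset ((j : Fin n) → Fin (i j)) =>
        S.card = k ∧ ∀ j, ∀ a : Fin (i j), ∃ x ∈ S, x j = a)).card : ℤ)
      = ∑ m ∈ Fintype.piFinset (fun j => Finset.range (i j + 1)),
          (-1 : ℤ) ^ (∑ j, m j) * (∏ j, ((i j).choose (m j) : ℤ)) *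
            (((∏ j, (i j - m j)).choose k : ℤ)) := by
  have hsum := sum_comp_card_pi (α := fun j => Fin (i j)) (R := ℤ)
    (fun m => (-1) ^ (∑ j, m j) * (((∏ j, (i j - m j)).choose k : ℕ) : ℤ))
  simp only [Fintype.card_fin] at hsum
  rw [Finset.sum_congr rfl fun m _ => by
    rw [mul_comm ((-1 : ℤ) ^ (∑ j, m j)), mul_assoc], ← hsum]
  have hset : Finset.univ.filter (fun S : Finset ((j : Fin n) → Fin (i j)) =>
      S.card = k ∧ ∀ j, ∀ a : Fin (i j), ∃ x ∈ S, x j = a) =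
      (Finset.powersetCard k Finset.univ).filter
        (fun S => ∀ j, S.image (fun x => x j) = Finset.univ) := by
    ext S
    simp [Finset.mem_powersetCard, Finset.eq_univ_iff_forall]
  rw [hset, Finset.card_filter, Nat.cast_sum]
  calc
    _ = ∑ S ∈ Finset.powersetCard k (Finset.univ : Finset ((j : Fin n) → Fin (i j))),
        ∏ j, ∑ A : Finset (Fin (i j)),
          (if Disjoint A (S.image (fun x => x j)) then (-1 : ℤ) ^ A.card else 0) := by
      refine Finset.sum_congr rfl fun S _ => ?_
      simp only [sum_neg_one_pow_card_of_disjoint, Finset.prod_ite_zero]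
      simp
    _ = ∑ S ∈ Finset.powersetCard k (Finset.univ : Finset ((j : Fin n) → Fin (i j))),
        ∑ A : (j : Fin n) → Finset (Fin (i j)),
          (if ∀ j, Disjoint (A j) (S.image (fun x => x j))
            then (-1 : ℤ) ^ (∑ j, (A j).card) else 0) := by
      refine Finset.sum_congr rfl fun S _ => ?_
      rw [Fintype.prod_sum]
      simp only [Finset.prod_ite_zero, Finset.prod_pow_eq_pow_sum, Finset.mem_univ, true_imp_iff]
    _ = _ := by
      rw [Finset.sum_comm]
      refine Finset.sum_congr rfl fun A _ => ?_
      rw [← Finset.sum_filter, Finset.sum_const, card_filter_disjoint_projections, nsmul_eq_mul,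
        mul_comm]
      simp only [Fintype.card_fin]
end

section
/- Let n ≥ 1, let i_1, …, i_n be positive natural numbers, and let k ≥ 1. For j = 1,…,n and r ∈ I_j = {1,…,i_j}, let B_{j,r} be the collection of k-element subsets S of I_1 × ⋯ × I_n such that no element of S has j-th coordinate equal to r. Then the cardinality of the union ⋃_{j=1}^n ⋃_{r∈I_j} B_{j,r} equals ∑' (−1)^{m_1+⋯+m_n−1} · C(i_1,m_1)⋯C(i_n,m_n) · C((i_1−m_1)⋯(i_n−m_n), k), where the sum ∑' ranges over all tuples (m_1,…,m_n) with 0 ≤ m_j ≤ i_j for each j, excluding the tuple m_1 = ⋯ = m_n = 0. -/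
open Finset in
/-- The `k`-subsets of a finite product of types that avoid, in each coordinate `j`, all values of
`R j` are the `k`-subsets of the product of the complements of the `R j`. -/
theorem card_filter_avoiding {ι : Type*} [Fintype ι] [DecidableEq ι] {α : ι → Type*}
    [∀ j, Fintype (α j)] [∀ j, DecidableEq (α j)] (k : ℕ) (R : ∀ j, Finset (α j)) :
    #{S : Finset (∀ j, α j) | #S = k ∧ ∀ j, ∀ r ∈ R j, ∀ x ∈ S, x j ≠ r}
      = (∏ j, (Fintype.card (α j) - #(R j))).choose k := by
  have h : ({S : Finset (∀ j, α j) | #S = k ∧ ∀ j, ∀ r ∈ R j, ∀ x ∈ S, x j ≠ r} : Finset _)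
      = powersetCard k (Fintype.piFinset fun j => (R j)ᶜ) := by
    ext S
    simp only [mem_filter, mem_univ, true_and, mem_powersetCard, subset_iff,
      Fintype.mem_piFinset, mem_compl]
    grind
  simp [h, card_compl]

open Finset in
/-- Summing over families of subsets a function of their sizes. -/
theorem sum_families_card {ι M : Type*} [Fintype ι] [DecidableEq ι] {α : ι → Type*}
    [∀ j, Fintype (α j)] [∀ j, DecidableEq (α j)] [CommSemiring M] (f : (ι → ℕ) → M) :
    ∑ R : ∀ j, Finset (α j), f (fun j => #(R j))
      = ∑ m ∈ Fintype.piFinset (fun j => range (Fintype.card (α j) + 1)),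
          (∏ j, ((Fintype.card (α j)).choose (m j) : M)) * f m := by
  rw [← sum_fiberwise_of_maps_to
    (t := Fintype.piFinset (fun j => range (Fintype.card (α j) + 1)))
    (g := fun R j => #(R j))
    (fun R _ => by simp [card_le_univ])]
  refine sum_congr rfl fun m _ => ?_
  have h : ({R : ∀ j, Finset (α j) | (fun j => #(R j)) = m} : Finset _)
      = Fintype.piFinset fun j => powersetCard (m j) univ := by
    ext R
    simp [funext_iff]
  rw [sum_congr rfl fun R hR => congrArg f (mem_filter.1 hR).2, sum_const, h]
  simp

open Finset in
/-- Inclusion-exclusion for the `k`-subsets of a finite product that attain every value in every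
coordinate. -/
theorem card_filter_not_avoiding {ι : Type*} [Fintype ι] [DecidableEq ι] {α : ι → Type*}
    [∀ j, Fintype (α j)] [∀ j, DecidableEq (α j)]
    [DecidablePred fun S : Finset (∀ j, α j) => ∃ j, ∃ r, ∀ x ∈ S, x j ≠ r] (k : ℕ) :
    (#{S : Finset (∀ j, α j) | #S = k ∧ ¬ ∃ j, ∃ r, ∀ x ∈ S, x j ≠ r} : ℤ)
      = ∑ m ∈ Fintype.piFinset (fun j => range (Fintype.card (α j) + 1)),
          (∏ j, ((Fintype.card (α j)).choose (m j) : ℤ)) * ((-1) ^ (∑ j, m j) *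
            ((∏ j, (Fintype.card (α j) - m j)).choose k : ℤ)) := by
  rw [← sum_families_card (fun m => (-1 : ℤ) ^ (∑ j, m j) *
    ((∏ j, (Fintype.card (α j) - m j)).choose k : ℤ))]
  have hcard (p : Finset (∀ j, α j) → Prop) [DecidablePred p] :
      (#{S | #S = k ∧ p S} : ℤ) = ∑ S with #S = k, if p S then 1 else 0 := by
    rw [← filter_filter, card_filter, Nat.cast_sum]
    simp only [Nat.cast_ite, Nat.cast_one, Nat.cast_zero]
  simp_rw [← card_filter_avoiding k, hcard, mul_sum]
  rw [sum_comm]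
  refine sum_congr rfl fun S _ => ?_
  let T : ∀ j, Finset (α j) := fun j => {r | ∀ x ∈ S, x j ≠ r}
  have hT : (∃ j, ∃ r, ∀ x ∈ S, x j ≠ r) ↔ ∃ j, T j ≠ ∅ := by
    simp [T]
  have hR (R : ∀ j, Finset (α j)) :
      (∀ j, ∀ r ∈ R j, ∀ x ∈ S, x j ≠ r) ↔ R ∈ Fintype.piFinset fun j => (T j).powerset := by
    simp [T, subset_iff]
  simp_rw [hR, mul_ite, mul_one, mul_zero]
  rw [← sum_filter, filter_mem_eq_inter, univ_inter]
  simp_rw [← prod_pow_eq_pow_sum]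
  rw [← prod_univ_sum (fun j => (T j).powerset) (fun j s => (-1 : ℤ) ^ #s)]
  simp_rw [sum_powerset_neg_one_pow_card, hT]
  rw [prod_ite_zero]
  simp


/-- Inclusion-exclusion for the union of the sets `B_{j,r}` of `k`-subsets of
`I_1 × ⋯ × I_n` avoiding the value `r` in coordinate `j`: the union has cardinality
`∑' (-1)^(m_1+⋯+m_n-1) C(i_1,m_1)⋯C(i_n,m_n) C((i_1-m_1)⋯(i_n-m_n), k)`,
the sum ranging over all `0 ≤ m_j ≤ i_j` except the all-zero tuple. -/
theorem union_avoiding_card (n : ℕ) (hn : 1 ≤ n)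
    (i : Fin n → ℕ) (hi : ∀ j, 1 ≤ i j) (k : ℕ) (hk : 1 ≤ k) :
    ((Finset.univ.filter (fun S : Finset ((j : Fin n) → Fin (i j)) =>
        S.card = k ∧ ∃ j, ∃ r : Fin (i j), ∀ x ∈ S, x j ≠ r)).card : ℤ)
      = ∑ m ∈ (Fintype.piFinset (fun j => Finset.range (i j + 1))).filter
            (fun m => m ≠ fun _ => 0),
          (-1 : ℤ) ^ (∑ j, m j - 1) * (∏ j, ((i j).choose (m j) : ℤ)) *
            (((∏ j, (i j - m j)).choose k : ℤ)) := by
  have hc := card_filter_not_avoiding (α := fun j => Fin (i j)) k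
  have htot := Finset.card_filter_add_card_filter_not
    (s := Finset.univ.filter (fun S : Finset ((j : Fin n) → Fin (i j)) => S.card = k))
    (fun S => ∃ j, ∃ r : Fin (i j), ∀ x ∈ S, x j ≠ r)
  have hk' : (Finset.univ.filter
      (fun S : Finset ((j : Fin n) → Fin (i j)) => S.card = k)).card = (∏ j, i j).choose k := by
    simpa only [Finset.notMem_empty, false_imp_iff, imp_true_iff, implies_true, and_true,
      Finset.card_empty, tsub_zero, Fintype.card_fin] using card_filter_avoiding (α := fun j => Fin (i j)) k fun _ => ∅
  rw [Finset.filter_filter, Finset.filter_filter, hk'] at htot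
  simp only [Fintype.card_fin] at hc
  have h0 : (fun _ => 0) ∈ Fintype.piFinset (fun j => Finset.range (i j + 1)) := by simp
  rw [← Finset.add_sum_erase _ _ h0] at hc
  rw [Finset.filter_ne']
  have hsum : ∑ m ∈ (Fintype.piFinset (fun j => Finset.range (i j + 1))).erase (fun _ => 0),
        (-1 : ℤ) ^ (∑ j, m j - 1) * (∏ j, ((i j).choose (m j) : ℤ)) *
          (((∏ j, (i j - m j)).choose k : ℤ))
      = -∑ m ∈ (Fintype.piFinset (fun j => Finset.range (i j + 1))).erase (fun _ => 0),
        (∏ j, ((i j).choose (m j) : ℤ)) * ((-1) ^ (∑ j, m j) *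
          ((∏ j, (i j - m j)).choose k : ℤ)) := by
    rw [← Finset.sum_neg_distrib]
    refine Finset.sum_congr rfl fun m hm => ?_
    have hpos : ∑ j, m j ≠ 0 := fun h => (Finset.mem_erase.1 hm).1 <| by
      simpa [funext_iff] using h
    obtain ⟨t, ht⟩ := Nat.exists_eq_succ_of_ne_zero hpos
    rw [ht, Nat.succ_sub_one, pow_succ]
    ring
  rw [hsum]
  have htot' := congrArg (Nat.cast : ℕ → ℤ) htot
  rw [Nat.cast_add] at htot'
  simp only [Finset.sum_const_zero, Nat.choose_zero_right, Nat.cast_one, Finset.prod_const_one,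
    pow_zero, one_mul, tsub_zero] at hc
  linarith
end

section
/- Let m and n be positive natural numbers. For 1 ≤ k ≤ mn, let t_k(m,n) be the number of k-element subsets S of the grid {1,…,m} × {1,…,n} such that every row index in {1,…,m} and every column index in {1,…,n} occurs as a coordinate of some element of S (i.e., every row and every column of the m × n array contains at least one chosen cell). Then ∑_{k=1}^{mn} (−1)^{k−1} t_k(m,n) = (−1)^{m+n}. (This is the two-dimensional case, the result of Wang, Lee, and Tan, which Theorem 1 of the paper generalizes.) -/
/-- The indicator of a conjunction is the product of the indicators. -/
theorem ite_and_one_zero (P Q : Prop) [Decidable P] [Decidable Q] :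
    (if P ∧ Q then (1 : ℤ) else 0) = (if P then 1 else 0) * (if Q then 1 else 0) := by
  by_cases hP : P <;> by_cases hQ : Q <;> simp [hP, hQ]

/-- Inclusion–exclusion over the points missed by the image of `S`. -/
theorem sum_neg_one_pow_card_avoiding_s4 {α γ : Type*} [Fintype α] [DecidableEq α]
    (f : γ → α) (S : Finset γ) :
    ∑ A : Finset α, (-1 : ℤ) ^ A.card * (if ∀ x ∈ S, f x ∉ A then 1 else 0)
      = if ∀ a, ∃ x ∈ S, f x = a then 1 else 0 := by
  have h : Finset.univ.filter (fun A : Finset α => ∀ x ∈ S, f x ∉ A)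
      = ((S.image f)ᶜ).powerset := by
    ext A
    simp only [Finset.mem_filter, Finset.mem_univ, true_and, Finset.mem_powerset,
      Finset.subset_iff, Finset.mem_compl, Finset.mem_image]
    grind
  simp only [mul_ite, mul_one, mul_zero]
  rw [← Finset.sum_filter, h, Finset.sum_powerset_neg_one_pow_card]
  congr 1
  simp [Finset.eq_univ_iff_forall]

/-- The alternating sum over subsets of the grid `Aᶜ × Bᶜ` vanishes unless that grid is empty. -/
theorem sum_neg_one_pow_card_subset_grid {α β : Type*} [Fintype α] [DecidableEq α]
    [Fintype β] [DecidableEq β] (A : Finset α) (B : Finset β) :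
    ∑ S : Finset (α × β), (-1 : ℤ) ^ S.card *
        ((if ∀ x ∈ S, x.1 ∉ A then 1 else 0) * (if ∀ x ∈ S, x.2 ∉ B then 1 else 0))
      = if A = Finset.univ ∨ B = Finset.univ then 1 else 0 := by
  have h : Finset.univ.filter
      (fun S : Finset (α × β) => (∀ x ∈ S, x.1 ∉ A) ∧ (∀ x ∈ S, x.2 ∉ B))
      = (Aᶜ ×ˢ Bᶜ).powerset := by
    ext S
    simp only [Finset.mem_filter, Finset.mem_univ, true_and, Finset.mem_powerset,
      Finset.subset_iff, Finset.mem_compl, Finset.mem_product]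
    grind
  simp only [← ite_and_one_zero]
  simp only [mul_ite, mul_one, mul_zero]
  rw [← Finset.sum_filter, h, Finset.sum_powerset_neg_one_pow_card]
  simp [Finset.product_eq_empty]

/-- The alternating sum over all subsets of a nonempty type vanishes. -/
theorem sum_neg_one_pow_card_finset (α : Type*) [Fintype α] [Nonempty α] :
    ∑ A : Finset α, (-1 : ℤ) ^ A.card = 0 := by
  classical
  rw [← Finset.powerset_univ, Finset.sum_powerset_neg_one_pow_card,
    if_neg Finset.univ_nonempty.ne_empty]

/-- The signed count of subsets of `α × β` that project onto both factors. -/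
theorem sum_neg_one_pow_card_covering (α β : Type*) [Fintype α] [DecidableEq α] [Nonempty α]
    [Fintype β] [DecidableEq β] [Nonempty β] :
    ∑ S : Finset (α × β), (-1 : ℤ) ^ S.card *
        (if (∀ a, ∃ x ∈ S, x.1 = a) ∧ (∀ b, ∃ x ∈ S, x.2 = b) then 1 else 0)
      = -(-1) ^ (Fintype.card α + Fintype.card β) := by
  calc
    _ = ∑ S : Finset (α × β), ∑ A : Finset α, ∑ B : Finset β,
          (-1 : ℤ) ^ A.card * (-1) ^ B.card * ((-1) ^ S.card *
            ((if ∀ x ∈ S, x.1 ∉ A then 1 else 0) * (if ∀ x ∈ S, x.2 ∉ B then 1 else 0))) := by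
      refine Finset.sum_congr rfl fun S _ => ?_
      rw [ite_and_one_zero, ← sum_neg_one_pow_card_avoiding_s4 Prod.fst,
        ← sum_neg_one_pow_card_avoiding_s4 Prod.snd, Finset.sum_mul_sum, Finset.mul_sum]
      refine Finset.sum_congr rfl fun A _ => ?_
      rw [Finset.mul_sum]
      refine Finset.sum_congr rfl fun B _ => ?_
      rw [mul_mul_mul_comm, mul_left_comm]
      congr!
    _ = ∑ A : Finset α, ∑ B : Finset β, (-1 : ℤ) ^ A.card * (-1) ^ B.card *
          (if A = Finset.univ ∨ B = Finset.univ then 1 else 0) := by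
      rw [Finset.sum_comm]
      refine Finset.sum_congr rfl fun A _ => ?_
      rw [Finset.sum_comm]
      refine Finset.sum_congr rfl fun B _ => ?_
      rw [← Finset.mul_sum, sum_neg_one_pow_card_subset_grid]
    _ = ∑ A : Finset α, ∑ B : Finset β,
          ((if A = Finset.univ then (-1 : ℤ) ^ A.card else 0) * (-1) ^ B.card
            + (-1) ^ A.card * (if B = Finset.univ then (-1 : ℤ) ^ B.card else 0)
            - (if A = Finset.univ then (-1 : ℤ) ^ A.card else 0) *
              (if B = Finset.univ then (-1 : ℤ) ^ B.card else 0)) := by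
      refine Finset.sum_congr rfl fun A _ => Finset.sum_congr rfl fun B _ => ?_
      by_cases hA : A = Finset.univ <;> by_cases hB : B = Finset.univ <;> simp [hA, hB]
    _ = _ := by
      simp only [Finset.sum_sub_distrib, Finset.sum_add_distrib, ← Finset.sum_mul_sum,
        sum_neg_one_pow_card_finset]
      simp [pow_add]


/-- The two-dimensional case (Wang, Lee, and Tan): if `t_k(m,n)` is the number of
`k`-subsets of the `m × n` grid meeting every row and every column, then
`∑_{k=1}^{mn} (-1)^(k-1) t_k(m,n) = (-1)^(m+n)`. -/
theorem wang_lee_tan (m n : ℕ) (hm : 1 ≤ m) (hn : 1 ≤ n) :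
    ∑ k ∈ Finset.Icc 1 (m * n),
      (-1 : ℤ) ^ (k - 1) *
        ((Finset.univ.filter (fun S : Finset (Fin m × Fin n) =>
            S.card = k ∧ (∀ a : Fin m, ∃ x ∈ S, x.1 = a) ∧
              (∀ b : Fin n, ∃ x ∈ S, x.2 = b))).card : ℤ)
      = (-1) ^ (m + n) := by
  have : NeZero m := ⟨by omega⟩
  have : NeZero n := ⟨by omega⟩
  have key := sum_neg_one_pow_card_covering (Fin m) (Fin n)
  simp only [mul_ite, mul_one, mul_zero, Fintype.card_fin] at key
  rw [← Finset.sum_filter] at key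
  rw [← neg_eq_iff_eq_neg.mpr key, ← Finset.sum_neg_distrib,
    ← Finset.sum_fiberwise_of_maps_to (t := Finset.Icc 1 (m * n)) (g := Finset.card)]
  · refine Finset.sum_congr rfl fun k hk => ?_
    rw [Finset.filter_filter, mul_comm, ← nsmul_eq_mul, ← Finset.sum_const]
    refine Finset.sum_congr (Finset.filter_congr fun S _ => and_comm) fun S hS => ?_
    obtain ⟨j, rfl⟩ := Nat.exists_eq_add_of_le' (Finset.mem_Icc.mp hk).1
    rw [(Finset.mem_filter.mp hS).2.2]
    simp [pow_succ]
  · intro S hS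
    obtain ⟨x, hx, -⟩ := (Finset.mem_filter.mp hS).2.1 0
    refine Finset.mem_Icc.mpr ⟨Finset.card_pos.mpr ⟨x, hx⟩, ?_⟩
    simpa using Finset.card_le_univ S
end
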